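/- Let K ⊂ ℝ^n be a convex body of class C²₊ with 0 in its interior. For x ∈ ∂K° and δ > 0 small, let x_δ be the point of ∂((K_δ)°) on the ray from 0 through x. Then there exist a constant c(K,n) > 0 (depending only on K and n) and δ₀ > 0 such that for all 0 < δ < δ₀ and all x ∈ ∂K°, (⟨x, N_{K°}(x)⟩ / (n δ^{2/(n+1)})) · [(‖x_δ‖/‖x‖)^n − 1] ≤ c(K,n). -/

import Mathlib

open MeasureTheory Filter Set
open scoped RealInnerProductSpace Topology NNReal ENNReal

noncomputable section

namespace LpAffine

/-- Euclidean space ℝⁿ. -/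
abbrev E (n : ℕ) := EuclideanSpace ℝ (Fin n)

/-- A convex body: a compact convex set with nonempty interior. -/
def IsConvexBody {n : ℕ} (K : Set (E n)) : Prop :=
  Convex ℝ K ∧ IsCompact K ∧ (interior K).Nonempty

/-- The polar body `K° = {y : ⟪x,y⟫ ≤ 1 ∀ x ∈ K}`. -/
def polarBody {n : ℕ} (K : Set (E n)) : Set (E n) := {y | ∀ x ∈ K, ⟪x, y⟫ ≤ 1}

/-- n-dimensional volume (Lebesgue). -/
def vol {n : ℕ} (K : Set (E n)) : ℝ := (volume K).toReal

/-- (n-1)-dimensional Hausdorff measure on ℝⁿ, used as boundary (surface) measure. -/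
def bdMeasure (n : ℕ) : Measure (E n) := μH[(n : ℝ) - 1]

/-- The surface area measure μ_K on ∂K. -/
def surfaceMeasure {n : ℕ} (K : Set (E n)) : Measure (E n) :=
  (bdMeasure n).restrict (frontier K)

/-- The centroid (center of gravity) of K is at the origin. -/
def CentroidAtOrigin {n : ℕ} (K : Set (E n)) : Prop := (∫ x in K, x) = (0 : E n)

/-- ν is an outer unit normal map for K: at each boundary point x, ν x is a unit vector
and the hyperplane through x with normal ν x supports K. -/
def IsOuterNormal {n : ℕ} (K : Set (E n)) (ν : E n → E n) : Prop :=
  ∀ x ∈ frontier K, ‖ν x‖ = 1 ∧ ∀ z ∈ K, ⟪z, ν x⟫ ≤ ⟪x, ν x⟫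

/-- k is the (generalized) Gaussian curvature of K at the boundary point x:
the density of the spherical image measure with respect to the surface measure at x. -/
def IsGaussCurvatureAt {n : ℕ} (K : Set (E n)) (ν : E n → E n) (x : E n) (k : ℝ) : Prop :=
  Tendsto (fun ε : ℝ =>
      (bdMeasure n (ν '' (frontier K ∩ Metric.ball x ε))).toReal /
        (bdMeasure n (frontier K ∩ Metric.ball x ε)).toReal)
    (𝓝[>] 0) (𝓝 k)

/-- κ is a generalized Gauss curvature function for K (defined μ_K-almost everywhere). -/
def IsGaussCurvature {n : ℕ} (K : Set (E n)) (ν : E n → E n) (κ : E n → ℝ) : Prop :=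
  ∀ᵐ x ∂(surfaceMeasure K), IsGaussCurvatureAt K ν x (κ x)

/-- K is of class C²₊ with outer normal map ν and Gaussian curvature κ:
K is a convex body, ν is a continuous outer normal map which maps ∂K bijectively onto the
unit sphere, and κ is a continuous, everywhere strictly positive Gaussian curvature. -/
def IsC2PlusBody {n : ℕ} (K : Set (E n)) (ν : E n → E n) (κ : E n → ℝ) : Prop :=
  IsConvexBody K ∧ IsOuterNormal K ν ∧
    ContinuousOn ν (frontier K) ∧ ContinuousOn κ (frontier K) ∧
    Set.BijOn ν (frontier K) (Metric.sphere (0 : E n) 1) ∧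
    ∀ x ∈ frontier K, IsGaussCurvatureAt K ν x (κ x) ∧ 0 < κ x

/-- The L_p affine surface area
`as_p(K) = ∫_{∂K} κ(x)^{p/(n+p)} / ⟪x, ν x⟫^{n(p-1)/(n+p)} dμ_K(x)`. -/
def asp {n : ℕ} (p : ℝ) (K : Set (E n)) (ν : E n → E n) (κ : E n → ℝ) : ℝ :=
  ∫ x in frontier K,
    κ x ^ (p / ((n : ℝ) + p)) / ⟪x, ν x⟫ ^ ((n : ℝ) * (p - 1) / ((n : ℝ) + p))
    ∂(bdMeasure n)

/-- The convex floating body K_δ: the intersection of all closed halfspaces whose defining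
hyperplanes cut off a set of volume δ from K. -/
def floatingBody {n : ℕ} (K : Set (E n)) (δ : ℝ) : Set (E n) :=
  ⋂ (u : E n) (t : ℝ) (_ : ‖u‖ = 1 ∧ vol (K ∩ {z | t ≤ ⟪z, u⟫}) = δ),
    {z : E n | ⟪z, u⟫ ≤ t}

/-- The surface body K_{f,s}: the intersection of all closed halfspaces H⁺ whose defining
hyperplanes H cut off a set of f μ_K-measure at most s from ∂K. -/
def surfaceBody {n : ℕ} (K : Set (E n)) (f : E n → ℝ) (s : ℝ) : Set (E n) :=
  ⋂ (u : E n) (t : ℝ)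
    (_ : ‖u‖ = 1 ∧ (∫ x in frontier K ∩ {z | t ≤ ⟪z, u⟫}, f x ∂(bdMeasure n)) ≤ s),
    {z : E n | ⟪z, u⟫ ≤ t}

/-- The constant c_n = 2 (|B₂^{n-1}|/(n+1))^{2/(n+1)}. -/
def cn (n : ℕ) : ℝ :=
  2 * ((volume (Metric.closedBall (0 : EuclideanSpace ℝ (Fin (n - 1))) 1)).toReal /
    ((n : ℝ) + 1)) ^ (2 / ((n : ℝ) + 1))

/-- The constant β_n = 2 |B₂^{n-1}|^{2/(n-1)}. -/
def betan (n : ℕ) : ℝ :=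
  2 * ((volume (Metric.closedBall (0 : EuclideanSpace ℝ (Fin (n - 1))) 1)).toReal) ^
    (2 / ((n : ℝ) - 1))

/-- The support function h_K(u) = sup_{x ∈ K} ⟪x, u⟫. -/
def suppFn {n : ℕ} (K : Set (E n)) (u : E n) : ℝ := sSup ((fun x => ⟪x, u⟫) '' K)

/-- The inverse Gauss map N_K⁻¹ : S^{n-1} → ∂K. -/
def gaussInv {n : ℕ} (K : Set (E n)) (ν : E n → E n) : E n → E n :=
  Function.invFunOn ν (frontier K)

/-- The curvature function f_K(u): the reciprocal of the Gaussian curvature at the boundary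
point with outer normal u. -/
def curvFn {n : ℕ} (K : Set (E n)) (ν : E n → E n) (κ : E n → ℝ) (u : E n) : ℝ :=
  1 / κ (gaussInv K ν u)

/-- The L_{-n} affine surface area
`as_{-n}(K) = max_{u ∈ S^{n-1}} f_K(u)^{1/2} h_K(u)^{(n+1)/2}`. -/
def asNegN {n : ℕ} (K : Set (E n)) (ν : E n → E n) (κ : E n → ℝ) : ℝ :=
  sSup ((fun u => curvFn K ν κ u ^ ((1 : ℝ) / 2) * suppFn K u ^ (((n : ℝ) + 1) / 2)) ''
    Metric.sphere (0 : E n) 1)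

/-- K is an ellipsoid: the image of the Euclidean unit ball under an invertible affine map. -/
def IsEllipsoid {n : ℕ} (K : Set (E n)) : Prop :=
  ∃ (L : E n ≃ₗ[ℝ] E n) (c : E n), K = (fun x => L x + c) '' Metric.closedBall (0 : E n) 1

/-! ### Cones, slabs and Hausdorff measure -/

/-- The union of the segments joining the origin to the points of `A`. -/
def originCone {n : ℕ} (A : Set (E n)) : Set (E n) :=
  (fun p : ℝ × E n => p.1 • p.2) '' (Icc 0 1 ×ˢ A)

theorem IsCompact.originCone {n : ℕ} {A : Set (E n)} (hA : IsCompact A) :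
    IsCompact (originCone A) :=
  (isCompact_Icc.prod hA).image (by fun_prop)

/-- Split off the `i`-th coordinate. -/
def splitCoord {m : ℕ} (i : Fin (m + 1)) (z : E (m + 1)) : ℝ × (Fin m → ℝ) :=
  (z i, fun j => z (i.succAbove j))

theorem measurePreserving_splitCoord {m : ℕ} (i : Fin (m + 1)) :
    MeasurePreserving (splitCoord i) volume volume :=
  (volume_preserving_piFinSuccAbove (fun _ => ℝ) i).comp (PiLp.volume_preserving_ofLp _)

/-- The union over `s ∈ I` of the slices `{s} × s • G`. -/
def slab {m : ℕ} (I : Set ℝ) (G : Set (Fin m → ℝ)) : Set (ℝ × (Fin m → ℝ)) :=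
  (fun p : ℝ × (Fin m → ℝ) => (p.1, p.1 • p.2)) '' (I ×ˢ G)

theorem isCompact_slab {m : ℕ} {I : Set ℝ} {G : Set (Fin m → ℝ)} (hI : IsCompact I)
    (hG : IsCompact G) : IsCompact (slab I G) :=
  (hI.prod hG).image (by fun_prop)

open scoped Pointwise in
theorem volume_slab {m : ℕ} {I : Set ℝ} {G : Set (Fin m → ℝ)} (hI : IsCompact I)
    (hG : IsCompact G) :
    volume (slab I G) = (∫⁻ s in I, ENNReal.ofReal |s ^ m|) * volume G := by
  rw [Measure.volume_eq_prod, Measure.prod_apply (isCompact_slab hI hG).measurableSet,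
    ← lintegral_mul_const _ (by fun_prop), ← lintegral_indicator hI.measurableSet]
  refine lintegral_congr fun s => ?_
  by_cases hs : s ∈ I
  · rw [indicator_of_mem hs]
    have : Prod.mk s ⁻¹' slab I G = s • G := by
      ext w
      simp only [slab, mem_preimage, mem_image, mem_prod, Prod.exists, Prod.mk.injEq, mem_smul_set]
      grind
    rw [this, Measure.addHaar_smul]
    simp
  · rw [indicator_of_notMem hs]
    have : Prod.mk s ⁻¹' slab I G = ∅ := by
      ext w
      simp only [slab, mem_preimage, mem_image, mem_prod, Prod.exists, Prod.mk.injEq,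
        mem_empty_iff_false]
      grind
    simp [this]

theorem volume_preimage_slab {m : ℕ} (i : Fin (m + 1)) {I : Set ℝ} {G : Set (Fin m → ℝ)}
    (hI : IsCompact I) (hG : IsCompact G) :
    volume (splitCoord i ⁻¹' slab I G) = (∫⁻ s in I, ENNReal.ofReal |s ^ m|) * volume G := by
  rw [(measurePreserving_splitCoord i).measure_preimage
    (isCompact_slab hI hG).measurableSet.nullMeasurableSet, volume_slab hI hG]

theorem volume_preimage_slab_le {m : ℕ} (i : Fin (m + 1)) {G : Set (Fin m → ℝ)}
    (hG : IsCompact G) :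
    volume (splitCoord i ⁻¹' slab (Icc (-1) 1) G) ≤ 2 * volume G := by
  rw [volume_preimage_slab i isCompact_Icc hG]
  gcongr
  calc ∫⁻ s in Icc (-1 : ℝ) 1, ENNReal.ofReal |s ^ m|
      ≤ ∫⁻ _ in Icc (-1 : ℝ) 1, 1 := by
        refine setLIntegral_mono measurable_const fun s hs => ?_
        rw [ENNReal.ofReal_le_one, abs_pow]
        exact pow_le_one₀ (abs_nonneg _) (abs_le.2 hs)
    _ = 2 := by
        simp; norm_num

theorem le_volume_preimage_slab {m : ℕ} (i : Fin (m + 1)) {I : Set ℝ} {G : Set (Fin m → ℝ)}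
    (hI : IsCompact I) (hG : IsCompact G) {c : ℝ} (hc : 0 ≤ c) (h : ∀ s ∈ I, c ≤ |s|) :
    ENNReal.ofReal (c ^ m) * volume I * volume G ≤ volume (splitCoord i ⁻¹' slab I G) := by
  rw [volume_preimage_slab i hI hG]
  refine mul_le_mul_left ?_ _
  rw [← setLIntegral_const]
  refine setLIntegral_mono (by fun_prop) fun s hs => ?_
  rw [abs_pow]
  exact ENNReal.ofReal_le_ofReal (pow_le_pow_left₀ hc (h s hs) m)

/-- The affine chart `z ↦ z / z i` of projective space, with the `i`-th coordinate dropped. -/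
def projChart {m : ℕ} (i : Fin (m + 1)) (z : E (m + 1)) : Fin m → ℝ :=
  (z i)⁻¹ • fun j => z (i.succAbove j)

theorem projChart_lipschitzOnWith {m : ℕ} (i : Fin (m + 1)) {c R : ℝ} (hc : 0 < c) (hR : 0 ≤ R) :
    LipschitzOnWith (Real.toNNReal (2 * R / c ^ 2)) (projChart i)
      {z | c ≤ |z i| ∧ ‖z‖ ≤ R} := by
  refine LipschitzOnWith.of_dist_le_mul fun z hz w hw => ?_
  rw [Real.coe_toNNReal _ (by positivity)]
  refine (dist_pi_le_iff (by positivity)).2 fun j => ?_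
  have hzi : 0 < |z i| := hc.trans_le hz.1
  have hwi : 0 < |w i| := hc.trans_le hw.1
  have hz0 : z i ≠ 0 := abs_pos.1 hzi
  have hw0 : w i ≠ 0 := abs_pos.1 hwi
  have key : ∀ k, |z k - w k| ≤ dist z w := fun k => by
    rw [dist_eq_norm]
    exact PiLp.norm_apply_le (z - w) k
  have bz : |z (i.succAbove j)| ≤ R := (PiLp.norm_apply_le z _).trans hz.2
  have bw : |w i| ≤ R := (PiLp.norm_apply_le w _).trans hw.2
  simp only [projChart, Pi.smul_apply, smul_eq_mul, Real.dist_eq]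
  have e : (z i)⁻¹ * z (i.succAbove j) - (w i)⁻¹ * w (i.succAbove j) =
      ((z (i.succAbove j) - w (i.succAbove j)) * z i
        + z (i.succAbove j) * (w i - z i)) / (z i * w i) := by
    field_simp
    ring
  have bzi : |z i| ≤ R := (PiLp.norm_apply_le z _).trans hz.2
  rw [e, abs_div, abs_mul, div_le_iff₀ (by positivity)]
  have h1 : |(z (i.succAbove j) - w (i.succAbove j)) * z i + z (i.succAbove j) * (w i - z i)|
      ≤ 2 * R * dist z w := by
    refine (abs_add_le _ _).trans ?_
    rw [abs_mul, abs_mul, abs_sub_comm (w i)]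
    have := mul_le_mul (key (i.succAbove j)) bzi (abs_nonneg _) dist_nonneg
    have := mul_le_mul bz (key i) (abs_nonneg _) hR
    linarith
  have h2 : c ^ 2 ≤ |z i| * |w i| := by
    rw [sq]
    exact mul_le_mul hz.1 hw.1 hc.le hzi.le
  calc _ ≤ 2 * R * dist z w := h1
    _ = 2 * R / c ^ 2 * dist z w * c ^ 2 := by field_simp
    _ ≤ _ := by gcongr

theorem exists_norm_le_mul_abs_apply {m : ℕ} (z : E (m + 1)) :
    ∃ i, ‖z‖ / (m + 1) ≤ |z i| := by
  by_contra! h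
  have h1 : ‖z‖ ^ 2 = ∑ i, |z i| ^ 2 := by
    simpa using EuclideanSpace.norm_sq_eq z
  have h2 : ∑ i, |z i| ^ 2 < ∑ _i : Fin (m + 1), (‖z‖ / (m + 1)) ^ 2 :=
    Finset.sum_lt_sum_of_nonempty Finset.univ_nonempty fun i _ =>
      pow_lt_pow_left₀ (h i) (abs_nonneg _) two_ne_zero
  rw [← h1] at h2
  simp only [Finset.sum_const, Finset.card_univ, Fintype.card_fin, nsmul_eq_mul] at h2
  push_cast at h2
  have h3 : ((m : ℝ) + 1) * (‖z‖ / (m + 1)) ^ 2 = ‖z‖ ^ 2 / (m + 1) := by field_simp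
  rw [h3] at h2
  have : ‖z‖ ^ 2 / ((m : ℝ) + 1) ≤ ‖z‖ ^ 2 :=
    div_le_self (by positivity) (by linarith [(m.cast_nonneg : (0 : ℝ) ≤ m)])
  linarith

theorem continuousOn_projChart {m : ℕ} (i : Fin (m + 1)) :
    ContinuousOn (projChart i) {z | z i ≠ 0} := by
  unfold projChart
  refine ContinuousOn.smul ((ContinuousOn.inv₀ (by fun_prop) fun z hz => hz)) (by fun_prop)

theorem hausdorffMeasure_pi_fin (m : ℕ) : (μH[(m : ℝ)] : Measure (Fin m → ℝ)) = volume := by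
  simpa using hausdorffMeasure_pi_real (ι := Fin m)

/-- For subsets of the sphere the cone volume is dominated by the Hausdorff measure. -/
theorem exists_volume_originCone_le (m : ℕ) :
    ∃ C : ℝ≥0, ∀ B : Set (E (m + 1)), IsCompact B → B ⊆ Metric.sphere 0 1 →
      volume (originCone B) ≤ C * μH[(m : ℝ)] B := by
  set c : ℝ := 1 / (m + 1) with hc
  have hc0 : 0 < c := by positivity
  set L : ℝ≥0 := Real.toNNReal (2 * 1 / c ^ 2) with hL
  refine ⟨(m + 1) * (2 * L ^ m), fun B hB hBs => ?_⟩
  set S : Fin (m + 1) → Set (E (m + 1)) := fun i => B ∩ {z | c ≤ |z i|} with hS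
  have hSc : ∀ i, IsCompact (S i) := fun i =>
    hB.inter_right (isClosed_le continuous_const (by fun_prop))
  have hSG : ∀ i, IsCompact (projChart i '' S i) := fun i =>
    (hSc i).image_of_continuousOn ((continuousOn_projChart i).mono fun z hz =>
      abs_pos.1 (hc0.trans_le hz.2))
  have hcover : originCone B ⊆ ⋃ i, splitCoord i ⁻¹' slab (Icc (-1) 1) (projChart i '' S i) := by
    rintro _ ⟨⟨r, z⟩, ⟨hr, hz⟩, rfl⟩
    have hz1 : ‖z‖ = 1 := by simpa using hBs hz
    obtain ⟨i, hi⟩ := exists_norm_le_mul_abs_apply z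
    rw [hz1] at hi
    have hzi : z i ≠ 0 := abs_pos.1 (hc0.trans_le hi)
    refine mem_iUnion.2 ⟨i, ⟨(r * z i, projChart i z), ⟨?_, z, ⟨hz, hi⟩, rfl⟩, ?_⟩⟩
    · have : |z i| ≤ 1 := hz1 ▸ PiLp.norm_apply_le z i
      rw [mem_Icc, ← abs_le, abs_mul, abs_of_nonneg hr.1]
      exact mul_le_one₀ hr.2 (abs_nonneg _) this
    · simp only [splitCoord, projChart, Prod.mk.injEq]
      refine ⟨by simp, ?_⟩
      ext j
      simp
      field_simp
  have hμ : ∀ i, volume (projChart i '' S i) ≤ L ^ m * μH[(m : ℝ)] B := fun i => by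
    rw [← hausdorffMeasure_pi_fin]
    have := ((projChart_lipschitzOnWith i hc0 zero_le_one).mono
      (show S i ⊆ _ from fun z hz => ⟨hz.2, (by simpa using hBs hz.1 : ‖z‖ = 1).le⟩)
      ).hausdorffMeasure_image_le (d := m) (by positivity)
    refine this.trans ?_
    rw [ENNReal.rpow_natCast]
    gcongr
    exact inter_subset_left
  calc volume (originCone B)
      ≤ ∑ i, volume (splitCoord i ⁻¹' slab (Icc (-1) 1) (projChart i '' S i)) :=
        (measure_mono hcover).trans (measure_iUnion_fintype_le _ _)
    _ ≤ ∑ _i : Fin (m + 1), 2 * (L ^ m * μH[(m : ℝ)] B) :=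
        Finset.sum_le_sum fun i _ => (volume_preimage_slab_le i (hSG i)).trans
          (by gcongr; exact hμ i)
    _ = _ := by
        simp
        ring

/-- The affine section of `projChart i` with `i`-th coordinate equal to one. -/
def projLift {m : ℕ} (i : Fin (m + 1)) (y : Fin m → ℝ) : E (m + 1) :=
  WithLp.toLp 2 (i.insertNth 1 y)

theorem smul_projLift_projChart {m : ℕ} (i : Fin (m + 1)) {z : E (m + 1)} (hz : z i ≠ 0) :
    z i • projLift i (projChart i z) = z := by
  ext k
  refine Fin.succAboveCases i ?_ (fun j => ?_) k
  · simp [projLift]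
  · simp [projLift, projChart]
    field_simp

theorem one_le_norm_projLift {m : ℕ} (i : Fin (m + 1)) (y : Fin m → ℝ) :
    1 ≤ ‖projLift i y‖ := by
  simpa [projLift] using PiLp.norm_apply_le (projLift i y) i

theorem exists_lipschitzWith_projLift (m : ℕ) :
    ∃ L : ℝ≥0, ∀ i : Fin (m + 1), LipschitzWith L (projLift i) := by
  refine ⟨_, fun i => (PiLp.lipschitzWith_toLp 2 (fun _ : Fin (m + 1) => ℝ)).comp
    (LipschitzWith.of_dist_le_mul (K := 1) fun y w => ?_)⟩
  refine (dist_pi_le_iff (by positivity)).2 fun k => ?_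
  refine Fin.succAboveCases i ?_ (fun j => ?_) k
  · simp
  · simpa using dist_le_pi_dist y w j

/-- Radial projection onto the boundary is Lipschitz away from the origin. -/
theorem gauge_inv_smul_lipschitzOnWith {F : Type*} [NormedAddCommGroup F] [NormedSpace ℝ F]
    {K : Set F} (hK : Convex ℝ K) {r R : ℝ} (hr : 0 < r) (hR : 0 < R)
    (hrK : Metric.ball 0 r ⊆ K) (hKR : K ⊆ Metric.closedBall 0 R) :
    LipschitzOnWith (Real.toNNReal (R + R * r⁻¹ * R)) (fun v => (gauge K v)⁻¹ • v)
      {v : F | 1 ≤ ‖v‖} := by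
  have hab : Absorbent ℝ K := absorbent_nhds_zero (Filter.mem_of_superset
    (Metric.ball_mem_nhds 0 hr) hrK)
  have hlow : ∀ v, ‖v‖ / R ≤ gauge K v := fun v => le_gauge_of_subset_closedBall hab hR.le hKR
  have hlip := hK.lipschitzWith_gauge (r := ⟨r, hr.le⟩) hr hrK
  refine LipschitzOnWith.of_dist_le_mul fun v hv w hw => ?_
  have pos : ∀ v : F, 1 ≤ ‖v‖ → 0 < gauge K v := fun v hv =>
    lt_of_lt_of_le (by positivity) (hlow v)
  have gv := pos v hv
  have gw := pos w hw
  have inv_le : (gauge K v)⁻¹ ≤ R := by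
    rw [inv_le_comm₀ gv hR]
    refine le_trans ?_ (hlow v)
    rw [inv_eq_one_div]
    gcongr
    exact hv
  have norm_le : (gauge K w)⁻¹ * ‖w‖ ≤ R := by
    have := hlow w
    rw [div_le_iff₀ hR] at this
    rw [inv_mul_le_iff₀ gw]
    exact this
  have hg : |gauge K w - gauge K v| ≤ r⁻¹ * ‖v - w‖ := by
    have := hlip.dist_le_mul w v
    rw [Real.dist_eq, dist_eq_norm, norm_sub_rev] at this
    exact this
  have e : (gauge K v)⁻¹ • v - (gauge K w)⁻¹ • w =
      (gauge K v)⁻¹ • (v - w)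
        + ((gauge K w - gauge K v) * (gauge K v)⁻¹) • ((gauge K w)⁻¹ • w) := by
    rw [smul_sub, smul_smul]
    have : (gauge K w - gauge K v) * (gauge K v)⁻¹ * (gauge K w)⁻¹ =
        (gauge K v)⁻¹ - (gauge K w)⁻¹ := by field_simp
    rw [this, sub_smul]
    abel
  rw [dist_eq_norm, dist_eq_norm, Real.coe_toNNReal _ (by positivity), e]
  refine (norm_add_le _ _).trans ?_
  rw [norm_smul, norm_smul, norm_smul, norm_mul, Real.norm_eq_abs, Real.norm_eq_abs,
    Real.norm_eq_abs, abs_of_pos (inv_pos.2 gv), abs_of_pos (inv_pos.2 gw)]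
  have h1 : (gauge K v)⁻¹ * ‖v - w‖ ≤ R * ‖v - w‖ := by gcongr
  have h2 : |gauge K w - gauge K v| * (gauge K v)⁻¹ * ((gauge K w)⁻¹ * ‖w‖) ≤
      r⁻¹ * ‖v - w‖ * R * R := by gcongr
  linarith

theorem volume_setOf_sign_mul_mem {σ : ℝ} (hσ : σ = 1 ∨ σ = -1) (a b : ℝ) :
    volume {s : ℝ | σ * s ∈ Icc a b} = ENNReal.ofReal (b - a) := by
  rcases hσ with rfl | rfl
  · simp only [one_mul, ofPred_mem_eq, Real.volume_Icc]
  · have : {s : ℝ | -1 * s ∈ Icc a b} = Icc (-b) (-a) := by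
      ext s
      simp only [mem_ofPred_eq, mem_Icc]
      constructor <;> rintro ⟨h1, h2⟩ <;> constructor <;> linarith
    rw [this, Real.volume_Icc]
    congr 1
    ring

theorem isCompact_setOf_sign_mul_mem {σ : ℝ} (hσ : σ = 1 ∨ σ = -1) (a b : ℝ) :
    IsCompact {s : ℝ | σ * s ∈ Icc a b} := by
  have : {s : ℝ | σ * s ∈ Icc a b} = (fun s => σ * s) '' Icc a b := by
    ext s
    simp only [mem_ofPred_eq, mem_image]
    rcases hσ with rfl | rfl <;> simp
    constructor
    · intro h
      exact ⟨_, h, by simp⟩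
    · rintro ⟨x, hx, rfl⟩
      simpa using hx
  rw [this]
  exact isCompact_Icc.image (by fun_prop)

/-- For subsets of the boundary of a convex body the Hausdorff measure is dominated by the
cone volume. -/
theorem exists_hausdorffMeasure_le {m : ℕ} {K : Set (E (m + 1))} (hK : Convex ℝ K)
    {r R : ℝ} (hr : 0 < r) (hR : 0 < R)
    (hrK : Metric.ball 0 r ⊆ K) (hKR : K ⊆ Metric.closedBall 0 R) :
    ∃ C : ℝ≥0, ∀ A : Set (E (m + 1)), IsCompact A → A ⊆ frontier K →
      μH[(m : ℝ)] A ≤ C * volume (originCone A) := by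
  set c : ℝ := r / (m + 1) with hc
  have hc0 : 0 < c := by positivity
  obtain ⟨L₁, hL₁⟩ := exists_lipschitzWith_projLift m
  have hψ := gauge_inv_smul_lipschitzOnWith hK hr hR hrK hKR
  set L₂ : ℝ≥0 := Real.toNNReal (R + R * r⁻¹ * R)
  set L := L₂ * L₁
  have h0 : K ∈ 𝓝 (0 : E (m + 1)) := Filter.mem_of_superset (Metric.ball_mem_nhds 0 hr) hrK
  set D : ℝ≥0 := Real.toNNReal ((c / 2) ^ m) * Real.toNNReal (c / 2) with hD
  have hD0 : D ≠ 0 := by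
    have : 0 < D := by rw [hD]; positivity
    exact this.ne'
  refine ⟨(m + 1) * 2 * (L ^ m * D⁻¹), fun A hA hAK => ?_⟩
  set σ : Bool → ℝ := fun b => if b then 1 else -1 with hσdef
  have hσ : ∀ b, σ b = 1 ∨ σ b = -1 := by intro b; cases b <;> simp [hσdef]
  set S : Fin (m + 1) × Bool → Set (E (m + 1)) :=
    fun p => A ∩ {z | c ≤ σ p.2 * z p.1} with hS
  have habs : ∀ p, ∀ z ∈ S p, σ p.2 * z p.1 = |z p.1| ∧ 0 < |z p.1| := by
    rintro ⟨i, b⟩ z ⟨_, hz⟩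
    have hz : c ≤ σ b * z i := hz
    rcases hσ b with h | h <;> simp only [h] at hz ⊢
    · have : 0 < z i := by linarith
      rw [abs_of_pos this]
      simp [this]
    · have : z i < 0 := by linarith
      rw [abs_of_neg this]
      simp [this]
  have hSc : ∀ p, IsCompact (S p) := fun p =>
    hA.inter_right (isClosed_le continuous_const (by fun_prop))
  set G : Fin (m + 1) × Bool → Set (Fin m → ℝ) := fun p => projChart p.1 '' S p with hG
  have hSG : ∀ p, IsCompact (G p) := fun p =>
    (hSc p).image_of_continuousOn ((continuousOn_projChart p.1).mono fun z hz =>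
      abs_pos.1 (habs p z hz).2)
  have hcover : A ⊆ ⋃ p, S p := by
    intro z hz
    obtain ⟨i, hi⟩ := exists_norm_le_mul_abs_apply z
    have hzr : r ≤ ‖z‖ := by
      by_contra! h
      have : z ∈ interior K := mem_interior.2 ⟨_, hrK, Metric.isOpen_ball, by simpa using h⟩
      exact (hAK hz).2 this
    have hi : c ≤ |z i| := le_trans (by rw [hc]; gcongr) hi
    rcases le_or_gt 0 (z i) with h | h
    · exact mem_iUnion.2 ⟨(i, true), hz, by simpa [hσdef, abs_of_nonneg h] using hi⟩
    · exact mem_iUnion.2 ⟨(i, false), hz, by simpa [hσdef, abs_of_neg h] using hi⟩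
  have hμ : ∀ p, μH[(m : ℝ)] (S p) ≤ L ^ m * volume (G p) := fun p => by
    have hf : LipschitzWith L₁ (fun y => σ p.2 • projLift p.1 y) := by
      refine LipschitzWith.of_dist_le_mul fun y w => ?_
      have := (hL₁ p.1).dist_le_mul y w
      rcases hσ p.2 with h | h <;> simp only [h] <;> simpa using this
    have hnorm : ∀ y, 1 ≤ ‖σ p.2 • projLift p.1 y‖ := fun y => by
      have := one_le_norm_projLift p.1 y
      rcases hσ p.2 with h | h <;> simp only [h] <;> simpa [norm_smul] using this
    have hcomp : LipschitzOnWith L ((fun v => (gauge K v)⁻¹ • v) ∘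
        fun y => σ p.2 • projLift p.1 y) (G p) :=
      hψ.comp (hf.lipschitzOnWith (s := G p)) fun y _ => hnorm y
    have hsub : S p ⊆ ((fun v => (gauge K v)⁻¹ • v) ∘
        fun y => σ p.2 • projLift p.1 y) '' G p := by
      intro z hz
      refine ⟨projChart p.1 z, ⟨z, hz, rfl⟩, ?_⟩
      obtain ⟨h1, h2⟩ := habs p z hz
      have hzz : |z p.1| • (σ p.2 • projLift p.1 (projChart p.1 z)) = z := by
        rw [← h1, smul_smul]
        have : σ p.2 * z p.1 * σ p.2 = z p.1 := by
          rcases hσ p.2 with h | h <;> rw [h] <;> ring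
        rw [this]
        exact smul_projLift_projChart p.1 (abs_pos.1 h2)
      set v := σ p.2 • projLift p.1 (projChart p.1 z) with hv
      have hg : |z p.1| * gauge K v = 1 := by
        have := (gauge_eq_one_iff_mem_frontier hK h0).2 (hAK hz.1)
        rwa [← hzz, gauge_smul_of_nonneg h2.le, smul_eq_mul] at this
      simp only [Function.comp_apply, ← hv]
      rw [inv_eq_of_mul_eq_one_left hg, hzz]
    refine (measure_mono hsub).trans ?_
    have := hcomp.hausdorffMeasure_image_le (d := m) (by positivity)
    rwa [hausdorffMeasure_pi_fin, ENNReal.rpow_natCast] at this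
  have hvol : ∀ p, D * volume (G p) ≤ volume (originCone A) := fun p => by
    set I : Set ℝ := {s : ℝ | σ p.2 * s ∈ Icc (c / 2) c} with hI
    have h1 := le_volume_preimage_slab p.1 (isCompact_setOf_sign_mul_mem (hσ p.2) (c / 2) c)
      (hSG p) (c := c / 2) (by positivity) (fun s hs => hs.1.trans (by
        rcases hσ p.2 with h | h <;> rw [h]
        · simpa using le_abs_self s
        · simpa using neg_le_abs s))
    rw [volume_setOf_sign_mul_mem (hσ p.2), show c - c / 2 = c / 2 by ring] at h1
    have h2 : splitCoord p.1 ⁻¹' slab I (G p) ⊆ originCone A := by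
      rintro w ⟨⟨s, y⟩, ⟨hs, z, hz, rfl⟩, hw⟩
      obtain ⟨e1, e2⟩ := habs p z hz
      have hz0 : z p.1 ≠ 0 := abs_pos.1 e2
      simp only [splitCoord, Prod.mk.injEq] at hw
      have hs : σ p.2 * s ∈ Icc (c / 2) c := hs
      have hzc : c ≤ σ p.2 * z p.1 := hz.2
      have hdiv : s / z p.1 = (σ p.2 * s) / (σ p.2 * z p.1) := by
        rcases hσ p.2 with h | h <;> rw [h] <;> field_simp
      refine ⟨(s / z p.1, z), ⟨⟨?_, ?_⟩, hz.1⟩, ?_⟩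
      · show 0 ≤ s / z p.1
        rw [hdiv]
        exact div_nonneg (by linarith [hs.1]) (by linarith)
      · show s / z p.1 ≤ 1
        rw [hdiv]
        exact div_le_one_of_le₀ (hs.2.trans hzc) (by linarith)
      · ext k
        refine Fin.succAboveCases p.1 ?_ (fun j => ?_) k
        · simp [← hw.1]
          field_simp
        · have := congrFun hw.2 j
          simp [projChart] at this
          simp [← this]
          field_simp
    refine le_trans (le_of_eq ?_) (h1.trans (measure_mono h2))
    rw [hD, ENNReal.coe_mul]
    rfl
  calc μH[(m : ℝ)] A ≤ ∑ p, μH[(m : ℝ)] (S p) :=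
        (measure_mono hcover).trans (measure_iUnion_fintype_le _ _)
    _ ≤ ∑ _p : Fin (m + 1) × Bool, (L ^ m * (D⁻¹ * volume (originCone A))) :=
        Finset.sum_le_sum fun p _ => (hμ p).trans (by
          gcongr
          rw [ENNReal.coe_inv hD0, ← ENNReal.div_eq_inv_mul, ENNReal.le_div_iff_mul_le (by simp [hD0]) (by simp),
            mul_comm]
          exact hvol p)
    _ = _ := by
        rw [Finset.sum_const, Finset.card_univ, nsmul_eq_mul]
        simp [ENNReal.coe_inv hD0]
        ring

/-! ### The spherical image is controlled by the surface measure -/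

theorem bdMeasure_succ (m : ℕ) : bdMeasure (m + 1) = μH[(m : ℝ)] := by
  simp [bdMeasure]

theorem measure_closedBall_le_of_forall_ball {α : Type*} [PseudoMetricSpace α] [MeasurableSpace α]
    [OpensMeasurableSpace α] (ρ μ : Measure α) [IsFiniteMeasure ρ] [IsFiniteMeasure μ]
    {x : α} {r ε : ℝ} (hr : r < ε)
    (h : ∀ s ∈ Ioo r ε, ρ (Metric.ball x s) ≤ μ (Metric.ball x s)) :
    ρ (Metric.closedBall x r) ≤ μ (Metric.closedBall x r) := by
  have e : ⋂ s > r, Metric.ball x s = Metric.closedBall x r := by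
    ext y
    simp only [mem_iInter, Metric.mem_ball, Metric.mem_closedBall]
    exact ⟨fun h => le_of_forall_gt h, fun h s hs => h.trans_lt hs⟩
  have key : ∀ μ : Measure α, IsFiniteMeasure μ →
      Tendsto (fun s => μ (Metric.ball x s)) (𝓝[>] r) (𝓝 (μ (Metric.closedBall x r))) := by
    intro μ _
    rw [← e]
    exact tendsto_measure_biInter_gt (fun s _ => Metric.isOpen_ball.measurableSet.nullMeasurableSet)
      (fun i j _ hij => Metric.ball_subset_ball hij) ⟨r + 1, by simp, measure_ne_top _ _⟩
  exact le_of_tendsto_of_tendsto (key ρ inferInstance) (key μ inferInstance)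
    (Filter.eventually_of_mem (Ioo_mem_nhdsGT hr) h)

theorem exists_bdMeasure_image_le {n : ℕ} {K : Set (E n)} {ν : E n → E n} {κ : E n → ℝ}
    (hK : IsCompact K) (hνc : ContinuousOn ν (frontier K)) (hκc : ContinuousOn κ (frontier K))
    (hmaps : MapsTo ν (frontier K) (Metric.sphere 0 1)) (hinj : InjOn ν (frontier K))
    (hκ : ∀ x ∈ frontier K, IsGaussCurvatureAt K ν x (κ x) ∧ 0 < κ x)
    (hfin : bdMeasure n (frontier K) ≠ ∞)
    (hfin' : bdMeasure n (Metric.sphere 0 1) ≠ ∞) :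
    ∃ M : ℝ≥0, ∀ A ⊆ frontier K, bdMeasure n (ν '' A) ≤ M * bdMeasure n A := by
  set F := frontier K with hF
  have hFc : IsCompact F := hK.of_isClosed_subset isClosed_frontier hK.isClosed.frontier_subset
  have : CompactSpace F := isCompact_iff_compactSpace.1 hFc
  obtain ⟨M, hM⟩ := (hFc.bddAbove_image hκc)
  have hM : ∀ x ∈ F, κ x < |M| + 1 := fun x hx => by
    have := hM ⟨x, hx, rfl⟩
    linarith [le_abs_self M]
  set M' : ℝ≥0 := Real.toNNReal (|M| + 1) with hM'
  set f : F → E n := fun x => ν x with hf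
  have hfe : MeasurableEmbedding f :=
    ((continuousOn_iff_continuous_domRestrict.1 hνc).isClosedEmbedding
      (injOn_iff_injective.1 hinj)).measurableEmbedding
  have hFm : MeasurableSet F := isClosed_frontier.measurableSet
  set ρ : Measure (E n) := ((bdMeasure n).comap f).map Subtype.val with hρ
  have hρa : ∀ s, ρ s = bdMeasure n (ν '' (F ∩ s)) := fun s => by
    rw [hρ, (MeasurableEmbedding.subtype_coe hFm).map_apply, hfe.comap_apply]
    congr 1
    ext y
    simp only [hf, mem_image, mem_preimage, mem_inter_iff, Subtype.exists]
    grind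
  have : IsFiniteMeasure ρ := ⟨by
    rw [hρa]
    refine (measure_mono ?_).trans_lt hfin'.lt_top
    rintro _ ⟨x, hx, rfl⟩
    exact hmaps hx.1⟩
  set μ : Measure (E n) := (bdMeasure n).restrict F with hμ
  have : IsFiniteMeasure μ := ⟨by simpa [hμ] using hfin.lt_top⟩
  refine ⟨M', fun A hA => ?_⟩
  have main : ρ A ≤ (M' • μ) A := by
    refine (Besicovitch.vitaliFamily ρ).measure_le_of_frequently_le (M' • μ)
      Measure.AbsolutelyContinuous.rfl A fun x hx => ?_
    obtain ⟨hlim, hpos⟩ := hκ x (hA hx)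
    obtain ⟨ε, hε, hball⟩ := mem_nhdsGT_iff_exists_Ioo_subset.1
      (hlim.eventually (Ioo_mem_nhds hpos (hM x (hA hx))))
    have hle : ∀ s ∈ Ioo 0 ε, ρ (Metric.ball x s) ≤ (M' • μ) (Metric.ball x s) := by
      intro s hs
      obtain ⟨h1, h2⟩ : 0 < (bdMeasure n (ν '' (F ∩ Metric.ball x s))).toReal /
          (bdMeasure n (F ∩ Metric.ball x s)).toReal ∧
          (bdMeasure n (ν '' (F ∩ Metric.ball x s))).toReal /
          (bdMeasure n (F ∩ Metric.ball x s)).toReal < |M| + 1 := hball hs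
      have hb : 0 < (bdMeasure n (F ∩ Metric.ball x s)).toReal := by
        refine lt_of_le_of_ne ENNReal.toReal_nonneg fun h => ?_
        simp [← h] at h1
      rw [div_lt_iff₀ hb] at h2
      rw [Measure.smul_apply, hμ, Measure.restrict_apply Metric.isOpen_ball.measurableSet,
        inter_comm, hρa, ENNReal.smul_def, smul_eq_mul,
        ← ENNReal.toReal_le_toReal]
      · rw [ENNReal.toReal_mul]
        refine h2.le.trans (le_of_eq ?_)
        rw [hM', ENNReal.coe_toReal, Real.coe_toNNReal _ (by positivity)]
      · rw [← hρa]
        exact measure_ne_top _ _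
      · exact ENNReal.mul_ne_top (by simp) 
          (ne_top_of_le_ne_top hfin (measure_mono inter_subset_left))
    refine (Besicovitch.tendsto_filterAt ρ x).frequently (Eventually.frequently ?_)
    filter_upwards [Ioo_mem_nhdsGT hε] with r hr
    exact measure_closedBall_le_of_forall_ball ρ (M' • μ) hr.2
      fun s hs => hle s ⟨hr.1.trans hs.1, hs.2⟩
  rw [hρa, inter_eq_self_of_subset_right hA] at main
  refine main.trans ?_
  rw [Measure.smul_apply, ENNReal.smul_def, smul_eq_mul]
  gcongr
  exact Measure.restrict_le_self

/-! ### Frames of maximal determinant -/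

theorem exists_matrix_of_span_eq_top {n : ℕ} {D : Set (Fin n → ℝ)} (hD : IsCompact D)
    (hspan : Submodule.span ℝ D = ⊤) :
    ∃ X : Matrix (Fin n) (Fin n) ℝ, (∀ i, X i ∈ D) ∧ X.det ≠ 0 ∧
      ∀ y ∈ D, ∃ a : Fin n → ℝ, (∀ i, |a i| ≤ 1) ∧ y = ∑ i, a i • X i := by
  obtain ⟨X₀, hX₀D, hX₀⟩ : ∃ X : Matrix (Fin n) (Fin n) ℝ, (∀ i, X i ∈ D) ∧ X.det ≠ 0 := by
    obtain ⟨f, hfD, -, hfi⟩ := Submodule.exists_fun_fin_finrank_span_eq ℝ D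
    have hn : n = Module.finrank ℝ (Submodule.span ℝ D) := by rw [hspan]; simp
    refine ⟨fun i => f (Fin.cast hn i), fun i => hfD _, ?_⟩
    have : LinearIndependent ℝ (fun i => f (Fin.cast hn i)) :=
      hfi.comp _ (Fin.cast_injective hn)
    have h := (Matrix.linearIndependent_rows_iff_isUnit
      (A := (fun i => f (Fin.cast hn i) : Matrix (Fin n) (Fin n) ℝ))).1 this
    exact ((Matrix.isUnit_iff_isUnit_det _).1 h).ne_zero
  have hpi : IsCompact {X : Matrix (Fin n) (Fin n) ℝ | ∀ i ∈ univ, X i ∈ D} :=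
    isCompact_univ_pi fun _ : Fin n => hD
  obtain ⟨X, hX, hmax⟩ := hpi.exists_isMaxOn ⟨X₀, fun i _ => hX₀D i⟩ (f := fun X : Matrix (Fin n) (Fin n) ℝ => |X.det|)
    (Continuous.continuousOn (by fun_prop))
  have hX0 : 0 < |X.det| := (abs_pos.2 hX₀).trans_le (hmax fun i _ => hX₀D i)
  have hdet : X.det ≠ 0 := abs_pos.1 hX0
  refine ⟨X, fun i => hX i trivial, hdet, fun y hy => ⟨Matrix.vecMul y X⁻¹, fun i => ?_, ?_⟩⟩
  · have hmem : ∀ j ∈ univ, X.updateRow i y j ∈ D := fun j _ => by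
      by_cases hj : j = i
      · subst hj; simpa using hy
      · rw [Matrix.updateRow_ne hj]; exact hX j trivial
    have h1 : |(X.updateRow i y).det| ≤ |X.det| := hmax hmem
    have h2 : y = ∑ k, Matrix.vecMul y X⁻¹ k • X k := by
      rw [← Matrix.vecMul_eq_sum, Matrix.vecMul_vecMul, Matrix.nonsing_inv_mul _ hdet.isUnit,
        Matrix.vecMul_one]
    have h3 : (X.updateRow i y).det = Matrix.vecMul y X⁻¹ i • X.det := by
      conv_lhs => rw [h2]
      exact Matrix.det_updateRow_sum X i _
    rw [h3, smul_eq_mul, abs_mul] at h1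
    exact le_of_mul_le_mul_right (by linarith) hX0
  · rw [← Matrix.vecMul_eq_sum, Matrix.vecMul_vecMul, Matrix.nonsing_inv_mul _ hdet.isUnit,
      Matrix.vecMul_one]

theorem ofReal_pow_le_volume_mul_volume {n : ℕ} (hn : 0 < n) {D : Set (Fin n → ℝ)}
    (hD : Convex ℝ D) (h0 : 0 ∈ D) {X : Matrix (Fin n) (Fin n) ℝ} (hX : ∀ i, X i ∈ D)
    (hdet : X.det ≠ 0) {h : ℝ} (hh : 0 < h) :
    ENNReal.ofReal ((2 * h / n ^ 2) ^ n) ≤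
      volume D * volume {v : Fin n → ℝ | ∀ i, |X i ⬝ᵥ v| < h / n} := by
  have hn' : (0 : ℝ) < n := by exact_mod_cast hn
  have h1 : ENNReal.ofReal (|X.det| * (1 / n) ^ n) ≤ volume D := by
    have hsub : Matrix.toLin' X.transpose '' (Set.pi univ fun _ => Icc 0 (1 / (n : ℝ))) ⊆ D := by
      rintro _ ⟨a, ha, rfl⟩
      have ha : ∀ i, a i ∈ Icc 0 (1 / (n : ℝ)) := fun i => ha i trivial
      rw [Matrix.toLin'_apply, Matrix.mulVec_transpose, Matrix.vecMul_eq_sum]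
      have hs : ∑ i, a i ≤ 1 := by
        calc ∑ i, a i ≤ ∑ _i : Fin n, 1 / (n : ℝ) := Finset.sum_le_sum fun i _ => (ha i).2
          _ = 1 := by simp; field_simp
      have h := hD.sum_mem (t := (Finset.univ : Finset (Option (Fin n))))
        (w := fun o => o.elim (1 - ∑ i, a i) a) (z := fun o => o.elim 0 fun i => X i)
        (fun o _ => by cases o <;> simp [hs, (ha _).1])
        (by simp [Fintype.sum_option]) (fun o _ => by cases o <;> simp [h0, hX])
      simpa [Fintype.sum_option] using h
    refine le_trans (le_of_eq ?_) (measure_mono hsub)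
    rw [Measure.addHaar_image_linearMap, LinearMap.det_toLin', Matrix.det_transpose,
      volume_pi_pi, ENNReal.ofReal_mul (abs_nonneg _), ENNReal.ofReal_pow (by positivity)]
    simp
  have h2 : volume {v : Fin n → ℝ | ∀ i, |X i ⬝ᵥ v| < h / n} =
      ENNReal.ofReal (|X.det|⁻¹ * (2 * h / n) ^ n) := by
    have : {v : Fin n → ℝ | ∀ i, |X i ⬝ᵥ v| < h / n} =
        Matrix.toLin' X ⁻¹' (Set.pi univ fun _ => Ioo (-(h / n)) (h / n)) := by
      ext v
      simp [Matrix.mulVec, abs_lt]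
    rw [this, Measure.addHaar_preimage_linearMap _ (by rwa [LinearMap.det_toLin']),
      LinearMap.det_toLin', volume_pi_pi, abs_inv, ENNReal.ofReal_mul (by positivity),
      ENNReal.ofReal_pow (by positivity)]
    simp only [Real.volume_Ioo, Finset.prod_const, Finset.card_univ, Fintype.card_fin]
    congr 3
    ring
  rw [h2]
  refine le_trans (le_of_eq ?_) (mul_le_mul_left h1 _)
  rw [← ENNReal.ofReal_mul (by positivity)]
  congr 1
  have : 0 < |X.det| := abs_pos.2 hdet
  calc _ = (1 / (n : ℝ)) ^ n * (2 * h / n) ^ n := by rw [← mul_pow]; congr 1; field_simp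
    _ = _ := by field_simp

/-- A convex body with a marked point `p` is contained in a parallelepiped centered at `p` whose
generators span points of the body; the dual parallelepiped is large. -/
theorem exists_frame {n : ℕ} (hn : 0 < n) {C : Set (E n)} (hC : Convex ℝ C) (hCc : IsCompact C)
    (hCi : (interior C).Nonempty) {p : E n} (hp : p ∈ C) :
    ∃ x : Fin n → E n, (∀ i, p + x i ∈ C) ∧
      (∀ z ∈ C, ∃ a : Fin n → ℝ, (∀ i, |a i| ≤ 1) ∧ z - p = ∑ i, a i • x i) ∧
      ∀ h : ℝ, 0 < h → ENNReal.ofReal ((2 * h / n ^ 2) ^ n) ≤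
        volume C * volume {v : E n | ∀ i, |⟪x i, v⟫| < h / n} := by
  set τ : (Fin n → ℝ) → E n := fun y => p + WithLp.toLp 2 y with hτ
  set e : (Fin n → ℝ) ≃ₜ E n :=
    (PiLp.homeomorph 2 (fun _ : Fin n => ℝ)).symm.trans (Homeomorph.addLeft p) with he
  have heτ : ⇑e = τ := rfl
  set D : Set (Fin n → ℝ) := τ ⁻¹' C with hD
  have hDc : IsCompact D := by
    have := e.isCompact_preimage.2 hCc
    rwa [heτ] at this
  have hDconv : Convex ℝ D := by
    intro y hy w hw a b ha hb hab
    have := hC hy hw ha hb hab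
    have e1 : a • τ y + b • τ w = τ (a • y + b • w) := by
      simp only [hτ, WithLp.toLp_add, WithLp.toLp_smul, smul_add]
      have : p = a • p + b • p := by rw [← add_smul, hab, one_smul]
      conv_rhs => rw [this]
      abel
    rwa [e1] at this
  have hD0 : (0 : Fin n → ℝ) ∈ D := by simpa [hD, hτ] using hp
  have hDi : (interior D).Nonempty := by
    rw [hD, ← heτ, ← e.preimage_interior]
    exact hCi.preimage e.surjective
  have hspan : Submodule.span ℝ D = ⊤ :=
    Submodule.eq_top_of_nonempty_interior' _ (hDi.mono (interior_mono Submodule.subset_span))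
  have hvol : volume D = volume C :=
    ((measurePreserving_add_left volume p).comp (PiLp.volume_preserving_toLp (Fin n))
      ).measure_preimage hCc.measurableSet.nullMeasurableSet
  obtain ⟨X, hX, hdet, hspanX⟩ := exists_matrix_of_span_eq_top hDc hspan
  refine ⟨fun i => WithLp.toLp 2 (X i), hX, fun z hz => ?_, fun h hh => ?_⟩
  · obtain ⟨a, ha, hza⟩ := hspanX (WithLp.ofLp (z - p)) (by simpa [hD, hτ] using hz)
    refine ⟨a, ha, ?_⟩
    have := congrArg (WithLp.toLp 2) hza
    simpa [WithLp.toLp_sum] using this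
  · refine (ofReal_pow_le_volume_mul_volume hn hDconv hD0 hX hdet hh).trans (le_of_eq ?_)
    rw [hvol]
    congr 1
    have hset : {v : Fin n → ℝ | ∀ i, |X i ⬝ᵥ v| < h / n} = WithLp.toLp 2 ⁻¹'
        {v : E n | ∀ i, |⟪WithLp.toLp 2 (X i), v⟫| < h / n} := by
      ext v
      simp only [mem_ofPred_eq, mem_preimage, EuclideanSpace.inner_toLp_toLp, star_trivial]
      simp only [dotProduct_comm]
    rw [hset]
    refine (PiLp.volume_preserving_toLp (Fin n)).measure_preimage
      (MeasurableSet.nullMeasurableSet ?_)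
    refine IsOpen.measurableSet ?_
    rw [show {v : E n | ∀ i, |⟪WithLp.toLp 2 (X i), v⟫| < h / n} =
      ⋂ i, {v : E n | |⟪WithLp.toLp 2 (X i), v⟫| < h / n} by ext; simp]
    exact isOpen_iInter_of_finite fun i => isOpen_lt (by fun_prop) continuous_const

/-! ### Volume of caps -/

open scoped Pointwise in
/-- The outer normals on the boundary part of a cap fill a cone whose volume is at least inverse
proportional to the volume of the cap. -/
theorem ofReal_pow_le_volume_cap_mul {n : ℕ} (hn : 0 < n) {K : Set (E n)} {ν : E n → E n}
    (hK : Convex ℝ K) (hKc : IsCompact K) (hν : IsOuterNormal K ν)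
    (hsurj : SurjOn ν (frontier K) (Metric.sphere 0 1)) {r R : ℝ} (hr : 0 < r) (hR : 0 < R)
    (hrK : Metric.ball 0 r ⊆ K) (hKR : K ⊆ Metric.closedBall 0 R) {u p : E n} (hu : ‖u‖ = 1)
    (hp : p ∈ K) {h : ℝ} (hh : 0 < h) (hhR : h ≤ 2 * R) :
    ENNReal.ofReal ((2 * h / n ^ 2) ^ n) ≤ volume (K ∩ {z | ⟪p, u⟫ - h ≤ ⟪z, u⟫}) *
      (ENNReal.ofReal ((1 + 4 * R / r) ^ n) *
        volume (originCone (ν '' (frontier K ∩ {z | ⟪p, u⟫ - h ≤ ⟪z, u⟫})))) := by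
  set C := K ∩ {z | ⟪p, u⟫ - h ≤ ⟪z, u⟫} with hC
  set A := frontier K ∩ {z | ⟪p, u⟫ - h ≤ ⟪z, u⟫} with hA
  have hn' : (0 : ℝ) < n := by exact_mod_cast hn
  have hclosed : IsClosed {z : E n | ⟪p, u⟫ - h ≤ ⟪z, u⟫} :=
    isClosed_le continuous_const (by fun_prop)
  have hCconv : Convex ℝ C := by
    refine hK.inter fun y hy w hw a b ha hb hab => ?_
    simp only [mem_ofPred_eq, inner_add_left, real_inner_smul_left] at hy hw ⊢
    calc ⟪p, u⟫ - h = a * (⟪p, u⟫ - h) + b * (⟪p, u⟫ - h) := by rw [← add_mul, hab, one_mul]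
      _ ≤ _ := by gcongr
  have hCc : IsCompact C := hKc.inter_right hclosed
  have hinner : ∀ z ∈ K, |⟪z, u⟫| ≤ R := fun z hz => by
    have h1 := abs_real_inner_le_norm z u
    have h2 : ‖z‖ ≤ R := by simpa using hKR hz
    rw [hu, mul_one] at h1
    exact h1.trans h2
  set s := h / (2 * R) with hs
  have hs0 : 0 < s := by positivity
  have hs1 : s ≤ 1 := div_le_one_of_le₀ hhR (by positivity)
  have hballC : Metric.ball ((1 - s) • p) (s * r) ⊆ C := by
    intro y hy
    set b := s⁻¹ • (y - (1 - s) • p) with hb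
    have hbK : b ∈ K := hrK (by
      rw [mem_ball_iff_norm] at hy
      rw [mem_ball_zero_iff, hb, norm_smul, Real.norm_eq_abs, abs_of_pos (inv_pos.2 hs0),
        inv_mul_lt_iff₀ hs0]
      exact hy)
    have hyb : y = (1 - s) • p + s • b := by
      rw [hb, smul_inv_smul₀ hs0.ne']
      abel
    refine ⟨hyb ▸ hK hp hbK (by linarith) hs0.le (by ring), ?_⟩
    show ⟪p, u⟫ - h ≤ ⟪y, u⟫
    rw [hyb, inner_add_left, real_inner_smul_left, real_inner_smul_left]
    have h1 := (abs_le.1 (hinner p hp)).2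
    have h2 := (abs_le.1 (hinner b hbK)).1
    have h3 : s * (2 * R) = h := by rw [hs]; field_simp
    nlinarith
  have hsr : 0 < s * r := by positivity
  have hCi : (interior C).Nonempty :=
    ⟨_, mem_interior.2 ⟨_, hballC, Metric.isOpen_ball, Metric.mem_ball_self hsr⟩⟩
  have hpC : p ∈ C := ⟨hp, show ⟪p, u⟫ - h ≤ ⟪p, u⟫ by linarith⟩
  obtain ⟨x, -, hxspan, hxvol⟩ := exists_frame hn hCconv hCc hCi hpC
  refine (hxvol h hh).trans ?_
  gcongr
  set Q := {v : E n | ∀ i, |⟪x i, v⟫| < h / n} with hQ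
  have hQC : ∀ v ∈ Q, ∀ z ∈ C, |⟪z - p, v⟫| < h := by
    intro v hv z hz
    obtain ⟨a, ha, hza⟩ := hxspan z hz
    rw [hza, sum_inner]
    calc |∑ i, ⟪a i • x i, v⟫| ≤ ∑ i, |⟪a i • x i, v⟫| := Finset.abs_sum_le_sum_abs _ _
      _ ≤ ∑ i, |⟪x i, v⟫| := Finset.sum_le_sum fun i _ => by
          rw [real_inner_smul_left, abs_mul]
          exact mul_le_of_le_one_left (abs_nonneg _) (ha i)
      _ < ∑ _i : Fin n, h / n := Finset.sum_lt_sum_of_nonempty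
          ⟨⟨0, hn⟩, Finset.mem_univ _⟩ fun i _ => hv i
      _ = h := by simp; field_simp
  have hQnorm : ∀ v ∈ Q, ‖v‖ ≤ 4 * R / r := by
    intro v hv
    rcases eq_or_ne v 0 with rfl | hv0
    · simp; positivity
    have hvn : 0 < ‖v‖ := norm_pos_iff.2 hv0
    set d := (s * r / 2 / ‖v‖) • v with hd
    have hdn : ‖d‖ < s * r := by
      rw [hd, norm_smul, Real.norm_eq_abs, abs_of_pos (by positivity), div_mul_cancel₀ _ hvn.ne']
      linarith
    have h1 := hQC v hv ((1 - s) • p + d) (hballC (by simpa using hdn))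
    have h2 := hQC v hv ((1 - s) • p - d) (hballC (by simpa using hdn))
    have h3 : ⟪d, v⟫ = s * r / 2 * ‖v‖ := by
      rw [hd, real_inner_smul_left, real_inner_self_eq_norm_sq]
      field_simp
    have e1 : ⟪(1 - s) • p + d - p, v⟫ = ⟪(1 - s) • p - p, v⟫ + ⟪d, v⟫ := by
      rw [← inner_add_left]; congr 1; abel
    have e2 : ⟪(1 - s) • p - d - p, v⟫ = ⟪(1 - s) • p - p, v⟫ - ⟪d, v⟫ := by
      rw [← inner_sub_left]; congr 1; abel
    rw [e1, h3] at h1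
    rw [e2, h3] at h2
    have h4 : s * r / 2 * ‖v‖ ≤ h := by linarith [(abs_lt.1 h1).2, (abs_lt.1 h2).1]
    have h5 : s * (4 * R / r) * (r / 2) = h := by rw [hs]; field_simp; ring
    have h6 : (s * r / 2) * ‖v‖ ≤ (s * r / 2) * (4 * R / r) := by linarith
    exact le_of_mul_le_mul_left h6 (by positivity)
  set L := 1 + 4 * R / r with hL
  have hL0 : 0 < L := by positivity
  have hdir : ∀ v ∈ Q, u + v ≠ 0 → ‖u + v‖⁻¹ • (u + v) ∈ ν '' A := by
    intro v hv hw
    have hwn : 0 < ‖u + v‖ := norm_pos_iff.2 hw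
    obtain ⟨y, hy, hyw⟩ := hsurj (a := ‖u + v‖⁻¹ • (u + v)) (by
      rw [mem_sphere_zero_iff_norm, norm_smul, norm_inv, norm_norm, inv_mul_cancel₀ hwn.ne'])
    refine ⟨y, ⟨hy, ?_⟩, hyw⟩
    show ⟪p, u⟫ - h ≤ ⟪y, u⟫
    by_contra! hlt
    have hyK : y ∈ K := hKc.isClosed.frontier_subset hy
    have h1 := (hν y hy).2 p hp
    rw [hyw, real_inner_smul_right, real_inner_smul_right] at h1
    have h1 := le_of_mul_le_mul_left h1 (inv_pos.2 hwn)
    have hden : 0 < ⟪p, u⟫ - ⟪y, u⟫ := by linarith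
    set l := h / (⟪p, u⟫ - ⟪y, u⟫) with hl
    have hl0 : 0 < l := by positivity
    have hl1 : l ≤ 1 := div_le_one_of_le₀ (by linarith) hden.le
    have hlu : l * (⟪p, u⟫ - ⟪y, u⟫) = h := div_mul_cancel₀ _ hden.ne'
    have hz : (1 - l) • p + l • y ∈ C := by
      refine ⟨hK hp hyK (by linarith) hl0.le (by ring), ?_⟩
      show ⟪p, u⟫ - h ≤ ⟪(1 - l) • p + l • y, u⟫
      rw [inner_add_left, real_inner_smul_left, real_inner_smul_left]
      linarith
    have h2 := (abs_lt.1 (hQC v hv _ hz)).2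
    have e : (1 - l) • p + l • y - p = l • (y - p) := by module
    rw [e, real_inner_smul_left, inner_sub_left] at h2
    rw [inner_add_right, inner_add_right] at h1
    nlinarith
  have hsub : Q ⊆ (fun v => u + v) ⁻¹' (L • originCone (ν '' A)) := by
    intro v hv
    rw [mem_preimage, mem_smul_set]
    by_cases hw : u + v = 0
    · have h0 := hdir 0 (by simp only [hQ, mem_ofPred_eq, inner_zero_right, abs_zero]
                            intro; positivity)
        (by rw [add_zero]; exact norm_ne_zero_iff.1 (by rw [hu]; norm_num))
      exact ⟨0, ⟨(0, _), ⟨⟨le_rfl, zero_le_one⟩, h0⟩, by simp⟩, by simp [hw]⟩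
    · have hwn : 0 < ‖u + v‖ := norm_pos_iff.2 hw
      have hle : ‖u + v‖ ≤ L := (norm_add_le _ _).trans (by
        rw [hu]; linarith [hQnorm v hv])
      refine ⟨_, ⟨(‖u + v‖ / L, _), ⟨⟨by positivity, div_le_one_of_le₀ hle hL0.le⟩,
        hdir v hv hw⟩, rfl⟩, ?_⟩
      simp only [smul_smul]
      have hscal : L * (‖u + v‖ / L * ‖u + v‖⁻¹) = 1 := by field_simp
      rw [hscal, one_smul]
  refine (measure_mono hsub).trans (le_of_eq ?_)
  rw [measure_preimage_add, Measure.addHaar_smul, abs_of_nonneg (by positivity)]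
  simp

open scoped Pointwise in
/-- The cone over the boundary part of a cap has volume at most inverse proportional to the height
of the cap, relative to the volume of the cap of twice the height. -/
theorem volume_originCone_mul_le {n : ℕ} (hn : 0 < n) {K : Set (E n)}
    (hK : Convex ℝ K) (hKc : IsCompact K) (h0 : (0 : E n) ∈ K) {R : ℝ} (hR : 0 < R)
    {u : E n} {M : ℝ} (hMR : M ≤ R) {h : ℝ} (hh : 0 < h) (hhM : h ≤ M) :
    ENNReal.ofReal (h / R) * volume (originCone (frontier K ∩ {z | M - h ≤ ⟪z, u⟫})) ≤
      volume (K ∩ {z | M - 2 * h ≤ ⟪z, u⟫}) := by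
  set A := frontier K ∩ {z | M - h ≤ ⟪z, u⟫} with hA
  have hs0 : 0 < h / R := by positivity
  have hs1 : h / R ≤ 1 := div_le_one_of_le₀ (hhM.trans hMR) hR.le
  set s := h / R with hs
  have hAK : ∀ z ∈ A, z ∈ K := fun z hz => hKc.isClosed.frontier_subset hz.1
  have hcompact : IsCompact A := (hKc.of_isClosed_subset isClosed_frontier
    hKc.isClosed.frontier_subset).inter_right (isClosed_le continuous_const (by fun_prop))
  have hsub : originCone A ⊆ K ∩ {z | M - 2 * h ≤ ⟪z, u⟫} ∪ (1 - s) • originCone A := by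
    rintro _ ⟨⟨t, z⟩, ⟨ht, hz⟩, rfl⟩
    rcases le_or_gt t (1 - s) with hts | hts
    · right
      rcases eq_or_lt_of_le (sub_nonneg.2 hs1) with h1 | h1
      · have : t = 0 := le_antisymm (hts.trans_eq h1.symm) ht.1
        exact mem_smul_set.2 ⟨(0 : ℝ) • z, ⟨(0, z), ⟨⟨le_rfl, zero_le_one⟩, hz⟩, rfl⟩,
          by simp [this]⟩
      · refine mem_smul_set.2 ⟨(t / (1 - s)) • z, ⟨(t / (1 - s), z),
          ⟨⟨div_nonneg ht.1 h1.le, div_le_one_of_le₀ hts h1.le⟩, hz⟩, rfl⟩, ?_⟩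
        simp only [smul_smul]
        rw [mul_div_cancel₀ _ h1.ne']
    · left
      refine ⟨hK.smul_mem_of_zero_mem h0 (hAK z hz) ht, ?_⟩
      show M - 2 * h ≤ ⟪t • z, u⟫
      rw [real_inner_smul_left]
      have hz' : M - h ≤ ⟪z, u⟫ := hz.2
      have h1 : t * (M - h) ≤ t * ⟪z, u⟫ := mul_le_mul_of_nonneg_left hz' ht.1
      have h2 : (1 - s) * (M - h) ≤ t * (M - h) :=
        mul_le_mul_of_nonneg_right hts.le (by linarith)
      have h3 : s * (M - h) ≤ s * R := mul_le_mul_of_nonneg_left (by linarith) hs0.le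
      have h4 : s * R = h := by rw [hs]; field_simp
      linarith
  have hfin : volume (originCone A) ≠ ∞ := (IsCompact.originCone hcompact).measure_ne_top
  have h1 : volume (originCone A) ≤ volume (K ∩ {z | M - 2 * h ≤ ⟪z, u⟫}) +
      ENNReal.ofReal (1 - s) * volume (originCone A) := by
    refine (measure_mono hsub).trans ((measure_union_le _ _).trans ?_)
    rw [Measure.addHaar_smul]
    gcongr
    rw [abs_of_nonneg (pow_nonneg (by linarith) _)]
    exact pow_le_of_le_one (by linarith) (by linarith) (by simpa using hn.ne')
  have h2 : volume (originCone A) = ENNReal.ofReal s * volume (originCone A) +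
      ENNReal.ofReal (1 - s) * volume (originCone A) := by
    rw [← add_mul, ← ENNReal.ofReal_add hs0.le (by linarith)]
    simp
  exact (ENNReal.add_le_add_iff_right (ENNReal.mul_ne_top ENNReal.ofReal_ne_top hfin)).1
    (h2.symm.le.trans h1)

/-- The volume of a cap of height `2 * h` is at least of order `h ^ ((n + 1) / 2)`. -/
theorem exists_pow_le_vol_cap_sq {n : ℕ} (hn : 0 < n) {K : Set (E n)} {ν : E n → E n}
    {κ : E n → ℝ} (hK : IsC2PlusBody K ν κ) {r R : ℝ} (hr : 0 < r) (hR : 0 < R)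
    (hrK : Metric.ball 0 r ⊆ K) (hKR : K ⊆ Metric.closedBall 0 R) :
    ∃ k : ℝ, 0 < k ∧ ∀ u p : E n, ‖u‖ = 1 → p ∈ K → ∀ h : ℝ, 0 < h → h ≤ ⟪p, u⟫ →
      h ^ (n + 1) ≤ k * vol (K ∩ {z | ⟪p, u⟫ - 2 * h ≤ ⟪z, u⟫}) ^ 2 := by
  obtain ⟨m, rfl⟩ : ∃ m, n = m + 1 := ⟨n - 1, by omega⟩
  obtain ⟨⟨hconv, hKc, -⟩, hν, hνc, hκc, hbij, hκ⟩ := hK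
  have hfc : IsCompact (frontier K) :=
    hKc.of_isClosed_subset isClosed_frontier hKc.isClosed.frontier_subset
  obtain ⟨C₁, hC₁⟩ := exists_volume_originCone_le m
  obtain ⟨C₂, hC₂⟩ := exists_hausdorffMeasure_le hconv hr hR hrK hKR
  have hfin : bdMeasure (m + 1) (frontier K) ≠ ∞ := by
    rw [bdMeasure_succ]
    exact ((hC₂ _ hfc subset_rfl).trans_lt (ENNReal.mul_lt_top ENNReal.coe_lt_top
      (IsCompact.originCone hfc).measure_lt_top)).ne
  have hfin' : bdMeasure (m + 1) (Metric.sphere 0 1) ≠ ∞ := by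
    obtain ⟨C, hC⟩ := exists_hausdorffMeasure_le (m := m)
      (convex_closedBall (0 : E (m + 1)) 1) one_pos one_pos Metric.ball_subset_closedBall subset_rfl
    rw [bdMeasure_succ]
    have hs := isCompact_sphere (0 : E (m + 1)) 1
    refine ((hC _ hs ?_).trans_lt (ENNReal.mul_lt_top ENNReal.coe_lt_top
      (IsCompact.originCone hs).measure_lt_top)).ne
    rw [frontier_closedBall _ one_ne_zero]
  obtain ⟨M, hM⟩ := exists_bdMeasure_image_le hKc hνc hκc hbij.mapsTo hbij.injOn hκ hfin hfin'
  set b : ℝ := (1 + 4 * R / r) ^ (m + 1) * (C₁ * (M * C₂)) with hb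
  have hb0 : 0 ≤ b := by positivity
  set N : ℝ := ((m + 1 : ℕ) : ℝ) with hN
  have hN0 : 0 < N := by positivity
  refine ⟨R * (N ^ 2 / 2) ^ (m + 1) * (b + 1), by positivity, ?_⟩
  intro u p hu hp h hh hhM
  have hMR : ⟪p, u⟫ ≤ R := by
    have h1 := real_inner_le_norm p u
    have h2 : ‖p‖ ≤ R := by simpa using hKR hp
    rw [hu, mul_one] at h1
    exact h1.trans h2
  have h0 : (0 : E (m + 1)) ∈ K := hrK (Metric.mem_ball_self hr)
  have e₁ := ofReal_pow_le_volume_cap_mul hn hconv hKc hν hbij.surjOn hr hR hrK hKR hu hp hh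
    (by linarith)
  have e₂ := volume_originCone_mul_le hn hconv hKc h0 hR (u := u) hMR hh hhM
  set A := frontier K ∩ {z | ⟪p, u⟫ - h ≤ ⟪z, u⟫} with hA
  set V := volume (K ∩ {z | ⟪p, u⟫ - 2 * h ≤ ⟪z, u⟫}) with hV
  have hVfin : V ≠ ∞ := ((measure_mono inter_subset_left).trans_lt hKc.measure_lt_top).ne
  have hAc : IsCompact A := hfc.inter_right (isClosed_le continuous_const (by fun_prop))
  have e₃ : volume (originCone (ν '' A)) ≤ C₁ * (M * (C₂ * volume (originCone A))) := by
    have hs : ν '' A ⊆ Metric.sphere 0 1 :=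
      (image_mono inter_subset_left).trans hbij.mapsTo.image_subset
    refine (hC₁ _ (hAc.image_of_continuousOn (hνc.mono inter_subset_left)) hs).trans ?_
    gcongr
    rw [← bdMeasure_succ]
    refine (hM A inter_subset_left).trans ?_
    gcongr
    rw [bdMeasure_succ]
    exact hC₂ A hAc inter_subset_left
  have e₄ : volume (K ∩ {z | ⟪p, u⟫ - h ≤ ⟪z, u⟫}) ≤ V := by
    refine measure_mono (inter_subset_inter_right _ fun z hz => ?_)
    have hz' : ⟪p, u⟫ - h ≤ ⟪z, u⟫ := hz
    show ⟪p, u⟫ - 2 * h ≤ ⟪z, u⟫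
    linarith
  have e₅ : ENNReal.ofReal ((2 * h / N ^ 2) ^ (m + 1)) * ENNReal.ofReal (h / R) ≤
      V * (ENNReal.ofReal b * V) := by
    calc _ ≤ V * (ENNReal.ofReal ((1 + 4 * R / r) ^ (m + 1)) *
          (C₁ * (M * (C₂ * volume (originCone A))))) * ENNReal.ofReal (h / R) := by
          gcongr
          exact e₁.trans (by gcongr)
      _ = V * (ENNReal.ofReal b * (ENNReal.ofReal (h / R) * volume (originCone A))) := by
          rw [hb, ENNReal.ofReal_mul (by positivity), ENNReal.ofReal_mul (by positivity),
            ENNReal.ofReal_mul (by positivity)]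
          simp only [ENNReal.ofReal_coe_nnreal]
          ring
      _ ≤ _ := by gcongr
  have e₆ := ENNReal.toReal_mono (ENNReal.mul_ne_top hVfin
    (ENNReal.mul_ne_top ENNReal.ofReal_ne_top hVfin)) e₅
  rw [ENNReal.toReal_mul, ENNReal.toReal_mul, ENNReal.toReal_mul,
    ENNReal.toReal_ofReal (by positivity), ENNReal.toReal_ofReal (by positivity),
    ENNReal.toReal_ofReal hb0] at e₆
  calc h ^ (m + 1 + 1) =
        R * (N ^ 2 / 2) ^ (m + 1) * ((2 * h / N ^ 2) ^ (m + 1) * (h / R)) := by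
        have : (N ^ 2 / 2) ^ (m + 1) * (2 * h / N ^ 2) ^ (m + 1) = h ^ (m + 1) := by
          rw [← mul_pow]
          congr 1
          field_simp
        calc _ = h ^ (m + 1) * h := pow_succ _ _
          _ = _ := by rw [← this]; field_simp
    _ ≤ R * (N ^ 2 / 2) ^ (m + 1) * (V.toReal * (b * V.toReal)) := by gcongr
    _ = R * (N ^ 2 / 2) ^ (m + 1) * b * V.toReal ^ 2 := by ring
    _ ≤ R * (N ^ 2 / 2) ^ (m + 1) * (b + 1) * V.toReal ^ 2 := by gcongr; linarith

/-! ### Floating bodies -/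

/-- The floating body `K_δ` contains a copy of `K` shrunk by a factor `1 - O(δ ^ (2 / (n + 1)))`. -/
theorem exists_smul_mem_floatingBody {n : ℕ} (hn : 0 < n) {K : Set (E n)} {ν : E n → E n}
    {κ : E n → ℝ} (hK : IsC2PlusBody K ν κ) {r R : ℝ} (hr : 0 < r) (hR : 0 < R)
    (hrK : Metric.ball 0 r ⊆ K) (hKR : K ⊆ Metric.closedBall 0 R) :
    ∃ C : ℝ, 0 < C ∧ ∃ δ₀ : ℝ, 0 < δ₀ ∧ ∀ δ ∈ Ioo 0 δ₀,
      C * δ ^ (2 / ((n : ℝ) + 1)) ≤ 1 / 2 ∧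
      ∀ z ∈ K, (1 - C * δ ^ (2 / ((n : ℝ) + 1))) • z ∈ floatingBody K δ := by
  obtain ⟨k, hk0, hk⟩ := exists_pow_le_vol_cap_sq hn hK hr hR hrK hKR
  have hKc : IsCompact K := hK.1.2.1
  set l := max 1 k with hl
  have hl0 : 0 < l := zero_lt_one.trans_le (le_max_left _ _)
  set C := 4 * l / r with hC
  have hC0 : 0 < C := by positivity
  set q : ℝ := 2 / ((n : ℝ) + 1) with hq
  have hq0 : 0 < q := by positivity
  refine ⟨C, hC0, (1 / (2 * C)) ^ q⁻¹, by positivity, fun δ hδ => ?_⟩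
  set d := δ ^ q with hd
  have hd0 : 0 < d := Real.rpow_pos_of_pos hδ.1 _
  have hdpow : d ^ (n + 1) = δ ^ 2 := by
    rw [hd, ← Real.rpow_natCast, ← Real.rpow_mul hδ.1.le, ← Real.rpow_natCast]
    congr 1
    rw [hq]
    push_cast
    field_simp
  have hdle : C * d ≤ 1 / 2 := by
    have h1 : d ≤ 1 / (2 * C) := by
      calc d ≤ ((1 / (2 * C)) ^ q⁻¹) ^ q := Real.rpow_le_rpow hδ.1.le hδ.2.le hq0.le
        _ = _ := Real.rpow_inv_rpow (by positivity) hq0.ne'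
    calc C * d ≤ C * (1 / (2 * C)) := by gcongr
      _ = 1 / 2 := by field_simp
  refine ⟨hdle, fun z hz => ?_⟩
  simp only [floatingBody, mem_iInter]
  rintro u t ⟨hu, ht⟩
  obtain ⟨p, hp, hpmax⟩ := hKc.exists_isMaxOn ⟨z, hz⟩
    (f := fun z => ⟪z, u⟫) (by fun_prop)
  have hpmax : ∀ z ∈ K, ⟪z, u⟫ ≤ ⟪p, u⟫ := hpmax
  have hMr : r / 2 ≤ ⟪p, u⟫ := by
    have h1 := hpmax ((r / 2) • u) (hrK (by
      rw [mem_ball_zero_iff, norm_smul, hu, Real.norm_eq_abs, abs_of_pos (by positivity)]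
      linarith))
    rwa [real_inner_smul_left, real_inner_self_eq_norm_sq, hu, one_pow, mul_one] at h1
  have hrC : r / 2 * C = 2 * l := by rw [hC]; field_simp; ring
  have hld : l * d < r / 2 := by nlinarith
  have hMt : ⟪p, u⟫ - t ≤ 2 * (l * d) := by
    by_contra! hlt
    have hmin : l * d < min ((⟪p, u⟫ - t) / 2) (r / 2) := lt_min (by linarith) hld
    set h := min ((⟪p, u⟫ - t) / 2) (r / 2) with hh
    have h0 : 0 < h := (by positivity : (0 : ℝ) < l * d).trans hmin
    have h1 := hk u p hu hp h h0 ((min_le_right _ _).trans hMr)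
    have h2 : vol (K ∩ {z | ⟪p, u⟫ - 2 * h ≤ ⟪z, u⟫}) ≤ δ := by
      rw [← ht]
      refine ENNReal.toReal_mono
        ((measure_mono inter_subset_left).trans_lt hKc.measure_lt_top).ne
        (measure_mono (inter_subset_inter_right _ fun w hw => ?_))
      have hw' : ⟪p, u⟫ - 2 * h ≤ ⟪w, u⟫ := hw
      have := min_le_left ((⟪p, u⟫ - t) / 2) (r / 2)
      show t ≤ ⟪w, u⟫
      linarith
    have h3 : h ^ (n + 1) ≤ (l * d) ^ (n + 1) := by
      calc h ^ (n + 1) ≤ k * δ ^ 2 := by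
            refine h1.trans ?_
            gcongr
            exact ENNReal.toReal_nonneg
        _ ≤ l ^ (n + 1) * δ ^ 2 := by
            gcongr
            exact (le_max_right 1 k).trans (le_self_pow₀ (le_max_left _ _) (by omega))
        _ = (l * d) ^ (n + 1) := by rw [mul_pow, hdpow]
    exact absurd (le_of_pow_le_pow_left₀ (by omega) (by positivity) h3) (not_le.2 hmin)
  show ⟪(1 - C * d) • z, u⟫ ≤ t
  rw [real_inner_smul_left]
  have h1 : (1 - C * d) * ⟪z, u⟫ ≤ (1 - C * d) * ⟪p, u⟫ :=
    mul_le_mul_of_nonneg_left (hpmax z hz) (by linarith)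
  have h2 : C * d * (r / 2) ≤ C * d * ⟪p, u⟫ := by gcongr
  have h3 : C * d * (r / 2) = 2 * (l * d) := by rw [← mul_assoc 2, ← hrC]; ring
  linarith

/-! ### Polar bodies -/

theorem isClosed_polarBody {n : ℕ} (K : Set (E n)) : IsClosed (polarBody K) := by
  have e : polarBody K = ⋂ x ∈ K, {y | ⟪x, y⟫ ≤ 1} := by
    ext y
    simp [polarBody]
  rw [e]
  exact isClosed_biInter fun x _ => isClosed_le (by fun_prop) continuous_const

theorem exists_one_le_inner_of_mem_frontier_polarBody {n : ℕ} {K : Set (E n)} (hK : IsCompact K)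
    (hne : K.Nonempty) {x : E n} (hx : x ∈ frontier (polarBody K)) : ∃ z ∈ K, 1 ≤ ⟪z, x⟫ := by
  obtain ⟨p, hp, hmax⟩ := hK.exists_isMaxOn hne (f := fun z => ⟪z, x⟫) (by fun_prop)
  refine ⟨p, hp, ?_⟩
  by_contra! hlt
  obtain ⟨R, hR⟩ := hK.isBounded.subset_closedBall 0
  have hR0 : 0 ≤ R := (norm_nonneg p).trans (by simpa using hR hp)
  set ε := (1 - ⟪p, x⟫) / (R + 1) with hε
  have hε0 : 0 < ε := div_pos (by linarith) (by linarith)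
  refine hx.2 (mem_interior.2 ⟨Metric.ball x ε, fun y hy z hz => ?_, Metric.isOpen_ball,
    Metric.mem_ball_self hε0⟩)
  have h1 : ⟪z, x⟫ ≤ ⟪p, x⟫ := hmax hz
  have h2 : ⟪z, y - x⟫ ≤ R * ε := by
    refine (real_inner_le_norm _ _).trans ?_
    gcongr
    · simpa using hR hz
    · rw [← dist_eq_norm]
      exact hy.le
  have h3 : (R + 1) * ε = 1 - ⟪p, x⟫ := mul_div_cancel₀ _ (by linarith)
  rw [inner_sub_right] at h2
  nlinarith

theorem norm_le_of_mem_polarBody {n : ℕ} {K : Set (E n)} {r : ℝ} (hr : 0 < r)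
    (hrK : Metric.ball 0 r ⊆ K) {x : E n} (hx : x ∈ polarBody K) : ‖x‖ ≤ 2 / r := by
  rcases eq_or_ne x 0 with rfl | hx0
  · simp; positivity
  have hxn : 0 < ‖x‖ := norm_pos_iff.2 hx0
  have h1 := hx ((r / 2 / ‖x‖) • x) (hrK (by
    rw [mem_ball_zero_iff, norm_smul, Real.norm_eq_abs, abs_of_pos (by positivity),
      div_mul_cancel₀ _ hxn.ne']
    linarith))
  rw [real_inner_smul_left, real_inner_self_eq_norm_sq] at h1
  rw [le_div_iff₀ hr]
  have : r / 2 / ‖x‖ * ‖x‖ ^ 2 = ‖x‖ * r / 2 := by field_simp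
  linarith

theorem pow_sub_one_le_of_mul_le_one {ρ a : ℝ} (hρ : 0 ≤ ρ) (ha : 0 ≤ a) (ha' : a ≤ 1 / 2)
    (h : ρ * (1 - a) ≤ 1) (n : ℕ) : ρ ^ n - 1 ≤ n * 2 ^ n * a := by
  have h1 : 1 - n * a ≤ (1 - a) ^ n := by
    have := one_add_mul_le_pow (a := -a) (by linarith) n
    simpa [sub_eq_add_neg] using this
  have h2 : ρ ≤ 2 := by nlinarith
  have h3 : ρ ^ n * (1 - a) ^ n ≤ 1 := by
    rw [← mul_pow]
    exact pow_le_one₀ (mul_nonneg hρ (by linarith)) h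
  have h4 : ρ ^ n ≤ 2 ^ n := by gcongr
  have h5 : ρ ^ n * (1 - n * a) ≤ ρ ^ n * (1 - a) ^ n := by gcongr
  have h6 : ρ ^ n * (n * a) ≤ 2 ^ n * (n * a) := by gcongr
  nlinarith

/-- Uniform upper bound on ∂K° for the floating-body quotient. -/
theorem statement2 (n : ℕ) (hn : 2 ≤ n)
    (K : Set (E n)) (ν ν' : E n → E n) (κ : E n → ℝ)
    (hK : IsC2PlusBody K ν κ) (h0 : (0 : E n) ∈ interior K)
    (hν' : IsOuterNormal (polarBody K) ν')
    (δ₁ : ℝ) (hδ₁ : 0 < δ₁)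
    (xδ : E n → ℝ → E n)
    (hxδ : ∀ x ∈ frontier (polarBody K), ∀ δ ∈ Set.Ioo (0 : ℝ) δ₁,
      xδ x δ ∈ frontier (polarBody (floatingBody K δ)) ∧ ∃ r : ℝ, 0 < r ∧ xδ x δ = r • x) :
    ∃ C : ℝ, 0 < C ∧ ∃ δ₀ : ℝ, 0 < δ₀ ∧
      ∀ x ∈ frontier (polarBody K), ∀ δ ∈ Set.Ioo (0 : ℝ) δ₀,
        ⟪x, ν' x⟫ / ((n : ℝ) * δ ^ (2 / ((n : ℝ) + 1))) * ((‖xδ x δ‖ / ‖x‖) ^ n - 1) ≤ C := by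
  have hn0 : 0 < n := by omega
  have hKc : IsCompact K := hK.1.2.1
  obtain ⟨r, hr, hrK⟩ := Metric.isOpen_iff.1 isOpen_interior 0 h0
  have hrK : Metric.ball 0 r ⊆ K := hrK.trans interior_subset
  obtain ⟨R, hR, hKR⟩ := hKc.isBounded.subset_closedBall_lt 0 0
  obtain ⟨C, hC, δ₀, hδ₀, hδ⟩ := exists_smul_mem_floatingBody hn0 hK hr hR hrK hKR
  refine ⟨2 / r * (2 ^ n * C), by positivity, min δ₀ δ₁, lt_min hδ₀ hδ₁, fun x hx δ hδ' => ?_⟩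
  have hδ0 : 0 < δ := hδ'.1
  obtain ⟨ha, hsub⟩ := hδ δ ⟨hδ0, hδ'.2.trans_le (min_le_left _ _)⟩
  obtain ⟨hxδF, ρ, hρ, hxδρ⟩ := hxδ x hx δ ⟨hδ0, hδ'.2.trans_le (min_le_right _ _)⟩
  have hd0 : 0 < δ ^ (2 / ((n : ℝ) + 1)) := Real.rpow_pos_of_pos hδ0 _
  set d := δ ^ (2 / ((n : ℝ) + 1)) with hd
  obtain ⟨z, hz, hzx⟩ :=
    exists_one_le_inner_of_mem_frontier_polarBody hKc ⟨0, interior_subset h0⟩ hx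
  have hx0 : 0 < ‖x‖ := by
    rw [norm_pos_iff]
    rintro rfl
    rw [inner_zero_right] at hzx
    linarith
  have hxP : x ∈ polarBody K := (isClosed_polarBody K).frontier_subset hx
  have hρa : ρ * (1 - C * d) ≤ 1 := by
    have h1 := (isClosed_polarBody _).frontier_subset hxδF _ (hsub z hz)
    rw [hxδρ, real_inner_smul_left, real_inner_smul_right] at h1
    have h2 : 0 ≤ (1 - C * d) * ρ := mul_nonneg (by linarith) hρ.le
    nlinarith
  have hquot : ‖xδ x δ‖ / ‖x‖ = ρ := by
    rw [hxδρ, norm_smul, Real.norm_eq_abs, abs_of_pos hρ, mul_div_cancel_right₀ _ hx0.ne']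
  have hpow := pow_sub_one_le_of_mul_le_one hρ.le (by positivity) ha hρa n
  obtain ⟨hν1, hνle⟩ := hν' x hx
  have hi0 : 0 ≤ ⟪x, ν' x⟫ := by
    simpa using hνle 0 (fun z _ => by simp)
  have hi1 : ⟪x, ν' x⟫ ≤ 2 / r := by
    have h1 := real_inner_le_norm x (ν' x)
    rw [hν1, mul_one] at h1
    exact h1.trans (norm_le_of_mem_polarBody hr hrK hxP)
  rw [hquot]
  calc ⟪x, ν' x⟫ / ((n : ℝ) * d) * (ρ ^ n - 1)
      ≤ ⟪x, ν' x⟫ / ((n : ℝ) * d) * (n * 2 ^ n * (C * d)) := by gcongr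
    _ = ⟪x, ν' x⟫ * (2 ^ n * C) := by
        have : (0 : ℝ) < n := by exact_mod_cast hn0
        field_simp
    _ ≤ 2 / r * (2 ^ n * C) := by gcongr
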